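/- arXiv:math/0003100 — 4 statements merged into one kernel-verified Lean document; each statement's English description precedes it below -/
import Mathlib

section
/- Let α, β ∈ ℝ, let u(p,q) = α·p + β·e^q, and let v : ℝ² → ℂ be smooth. Then for every integer k ≥ 2 and all (p,q) ∈ ℝ², P^k(u,v)(p,q) = (−1)^k · β · e^q · (∂_p^k v)(p,q). -/
/-- Partial derivative in the first (impulse) variable `p` of a function on `ℝ²`. -/
noncomputable def pderivP (f : ℝ × ℝ → ℂ) : ℝ × ℝ → ℂ :=
  fun x => deriv (fun s : ℝ => f (s, x.2)) x.1

/-- Partial derivative in the second (position) variable `q` of a function on `ℝ²`. -/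
noncomputable def pderivQ (f : ℝ × ℝ → ℂ) : ℝ × ℝ → ℂ :=
  fun x => deriv (fun s : ℝ => f (x.1, s)) x.2

/-- The bidifferential operators `P^r` of the Moyal star product for the standard
symplectic form `dp∧dq` on `ℝ²`:
`P^r(u,v) = Σ_{j=0}^{r} (−1)^j C(r,j) (∂_p^{r−j}∂_q^{j} u)(∂_q^{r−j}∂_p^{j} v)`. -/
noncomputable def moyalP (r : ℕ) (u v : ℝ × ℝ → ℂ) : ℝ × ℝ → ℂ :=
  fun x => ∑ j ∈ Finset.range (r + 1),
    (-1 : ℂ) ^ j * (r.choose j : ℂ) *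
      (pderivP^[r - j] (pderivQ^[j] u)) x * (pderivQ^[r - j] (pderivP^[j] v)) x

theorem pderivP_comp_snd (g : ℝ → ℂ) : pderivP (fun y => g y.2) = 0 := by
  funext x
  simp [pderivP]

theorem pderivP_iterate_comp_snd (g : ℝ → ℂ) {n : ℕ} (hn : n ≠ 0) :
    pderivP^[n] (fun y => g y.2) = 0 := by
  obtain ⟨m, rfl⟩ := Nat.exists_eq_succ_of_ne_zero hn
  rw [Function.iterate_succ_apply, pderivP_comp_snd]
  exact Function.iterate_fixed (pderivP_comp_snd fun _ => 0) m

theorem hasDerivAt_const_mul_ofReal_exp (β t : ℝ) :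
    HasDerivAt (fun s : ℝ => (β * Real.exp s : ℂ)) (β * Real.exp t) t :=
  (Real.hasDerivAt_exp t).ofReal_comp.const_mul (β : ℂ)

theorem pderivQ_generating_function (α β : ℝ) :
    pderivQ (fun y => (α * y.1 + β * Real.exp y.2 : ℂ)) =
      fun y => (β * Real.exp y.2 : ℂ) := by
  funext x
  exact ((hasDerivAt_const_mul_ofReal_exp β x.2).const_add (α * x.1 : ℂ)).deriv

theorem pderivQ_iterate_generating_function (α β : ℝ) {n : ℕ} (hn : n ≠ 0) :
    pderivQ^[n] (fun y => (α * y.1 + β * Real.exp y.2 : ℂ)) =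
      fun y => (β * Real.exp y.2 : ℂ) := by
  obtain ⟨m, rfl⟩ := Nat.exists_eq_succ_of_ne_zero hn
  rw [Function.iterate_succ_apply, pderivQ_generating_function]
  refine Function.iterate_fixed ?_ m
  funext x
  exact (hasDerivAt_const_mul_ofReal_exp β x.2).deriv

theorem pderivP_generating_function (α β : ℝ) :
    pderivP (fun y => (α * y.1 + β * Real.exp y.2 : ℂ)) = fun _ => (α : ℂ) := by
  funext x
  have h := (((hasDerivAt_id x.1).ofReal_comp.const_mul (α : ℂ)).add_const
    (β * Real.exp x.2 : ℂ)).deriv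
  simpa [pderivP] using h

theorem pderivP_iterate_generating_function (α β : ℝ) {n : ℕ} (hn : 2 ≤ n) :
    pderivP^[n] (fun y => (α * y.1 + β * Real.exp y.2 : ℂ)) = 0 := by
  obtain ⟨m, rfl⟩ := Nat.exists_eq_succ_of_ne_zero (show n ≠ 0 by omega)
  rw [Function.iterate_succ_apply, pderivP_generating_function]
  exact pderivP_iterate_comp_snd (fun _ => (α : ℂ)) (by omega)

/-- For the generating function `u(p,q) = αp + βe^q` of an element of `aff(ℝ)` and any
smooth `v`, one has `P^k(u,v) = (−1)^k β e^q ∂_p^k v` for every `k ≥ 2`. -/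
theorem moyalP_generating_function (α β : ℝ) (v : ℝ × ℝ → ℂ)
    (hv : ContDiff ℝ (⊤ : ℕ∞) v) (k : ℕ) (hk : 2 ≤ k) (x : ℝ × ℝ) :
    moyalP k (fun y => (α * y.1 + β * Real.exp y.2 : ℂ)) v x =
      (-1 : ℂ) ^ k * β * Real.exp x.2 * (pderivP^[k] v) x := by
  unfold moyalP
  rw [Finset.sum_range_succ, Finset.sum_eq_zero, zero_add,
    pderivQ_iterate_generating_function α β (show k ≠ 0 by omega)]
  · simp only [Nat.choose_self, Nat.sub_self, Function.iterate_zero, id_eq]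
    push_cast
    ring
  · intro j hj
    have hjk : j < k := Finset.mem_range.mp hj
    have hzero : pderivP^[k - j] (pderivQ^[j]
        (fun y => (α * y.1 + β * Real.exp y.2 : ℂ))) = 0 := by
      rcases eq_or_ne j 0 with rfl | hj0
      · exact pderivP_iterate_generating_function α β hk
      · rw [pderivQ_iterate_generating_function α β hj0]
        exact pderivP_iterate_comp_snd (fun t => (β * Real.exp t : ℂ)) (by omega)
    rw [hzero]
    simp
end

section
/- Let Z = αX + βY and T = α'X + β'Y be elements of aff(ℝ), with generating functions u(p,q) = αp + βe^q and v(p,q) = α'p + β'e^q on the open coadjoint orbit. Then P^r(u,v) = 0 identically for every r ≥ 2, the Moyal star products (iu)⋆(iv) and (iv)⋆(iu) are given by finite sums, and (iu)⋆(iv) − (iv)⋆(iu) = i·w, where w(p,q) = (αβ' − α'β)·e^q is the generating function of the bracket [Z,T] = (αβ' − α'β)Y. -/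
open Complex

/-- The Moyal star product `u ⋆ v = Σ_{r≥0} (1/r!) (1/(2i))^r P^r(u,v)` (pointwise sum of
the series). -/
noncomputable def moyal (u v : ℝ × ℝ → ℂ) : ℝ × ℝ → ℂ :=
  fun x => ∑' r : ℕ, ((r.factorial : ℂ)⁻¹ * (1 / (2 * I)) ^ r * moyalP r u v x)

/-- The function `(p, q) ↦ a p + b e^q` with complex coefficients. -/
noncomputable def affGen (a b : ℂ) : ℝ × ℝ → ℂ :=
  fun y => a * y.1 + b * Real.exp y.2

theorem pderivP_affGen (a b : ℂ) : pderivP (affGen a b) = fun _ => a := by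
  funext x
  have h : HasDerivAt (fun s : ℝ => a * (s : ℂ) + b * Real.exp x.2) (a * 1) x.1 :=
    ((hasDerivAt_id x.1).ofReal_comp.const_mul a).add_const _
  exact h.deriv.trans (mul_one a)

theorem pderivQ_affGen (a b : ℂ) : pderivQ (affGen a b) = affGen 0 b := by
  funext x
  have h : HasDerivAt (fun s : ℝ => a * (x.1 : ℂ) + b * Real.exp s) (b * Real.exp x.2) x.2 :=
    ((Real.hasDerivAt_exp x.2).ofReal_comp.const_mul b).const_add _
  exact h.deriv.trans (by simp [affGen])

theorem pderivP_const (c : ℂ) : pderivP (fun _ => c) = fun _ => 0 := by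
  funext x
  simp [pderivP]

theorem pderivQ_iterate_succ_affGen (a b : ℂ) (j : ℕ) :
    pderivQ^[j + 1] (affGen a b) = affGen 0 b := by
  induction j with
  | zero => exact pderivQ_affGen a b
  | succ j ih => rw [Function.iterate_succ_apply', ih, pderivQ_affGen]

theorem pderivP_iterate_succ_zero_affGen (b : ℂ) (k : ℕ) :
    pderivP^[k + 1] (affGen 0 b) = fun _ => 0 := by
  induction k with
  | zero => exact pderivP_affGen 0 b
  | succ k ih => rw [Function.iterate_succ_apply', ih, pderivP_const]

theorem pderivP_iterate_add_two_affGen (a b : ℂ) (k : ℕ) :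
    pderivP^[k + 2] (affGen a b) = fun _ => 0 := by
  induction k with
  | zero =>
    rw [Function.iterate_succ_apply', Function.iterate_one, pderivP_affGen, pderivP_const]
  | succ k ih => rw [Function.iterate_succ_apply', ih, pderivP_const]

theorem pderivQ_iterate_zero (k : ℕ) : pderivQ^[k] (fun _ => 0) = fun _ => 0 := by
  refine Function.iterate_fixed ?_ k
  funext x
  simp [pderivQ]

theorem moyalP_affGen_eq_zero (a b a' b' : ℂ) {r : ℕ} (hr : 2 ≤ r) (x : ℝ × ℝ) :
    moyalP r (affGen a b) (affGen a' b') x = 0 := by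
  refine Finset.sum_eq_zero fun j hj => ?_
  have hj' : j ≤ r := Nat.lt_succ_iff.mp (Finset.mem_range.mp hj)
  obtain ⟨m, rfl⟩ := Nat.exists_eq_add_of_le' hr
  rcases hj'.eq_or_lt with rfl | hlt
  · rw [pderivP_iterate_add_two_affGen a' b', pderivQ_iterate_zero, mul_zero]
  · rcases j with _ | j
    · simp only [Nat.sub_zero, Function.iterate_zero, id_eq]
      rw [pderivP_iterate_add_two_affGen, mul_zero, zero_mul]
    · obtain ⟨k, hk⟩ := Nat.exists_eq_add_of_lt hlt
      rw [show m + 2 - (j + 1) = k + 1 by omega, pderivQ_iterate_succ_affGen,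
        pderivP_iterate_succ_zero_affGen, mul_zero, zero_mul]

theorem moyalP_one_affGen (a b a' b' : ℂ) (x : ℝ × ℝ) :
    moyalP 1 (affGen a b) (affGen a' b') x = (a * b' - a' * b) * Real.exp x.2 := by
  simp only [moyalP, Finset.sum_range_succ, Finset.sum_range_zero, Nat.sub_zero, Nat.sub_self,
    Function.iterate_one, Function.iterate_zero, id_eq, pderivP_affGen, pderivQ_affGen]
  simp [affGen]
  ring

theorem moyal_affGen (a b a' b' : ℂ) (x : ℝ × ℝ) :
    moyal (affGen a b) (affGen a' b') x =
      ∑ r ∈ Finset.range 2, ((r.factorial : ℂ)⁻¹ * (1 / (2 * I)) ^ r *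
        moyalP r (affGen a b) (affGen a' b') x) := by
  refine tsum_eq_sum fun r hr => ?_
  rw [moyalP_affGen_eq_zero a b a' b' (not_lt.mp (mt Finset.mem_range.mpr hr)), mul_zero]

theorem moyal_affGen_sub_swap (a b a' b' : ℂ) (x : ℝ × ℝ) :
    moyal (affGen a b) (affGen a' b') x - moyal (affGen a' b') (affGen a b) x =
      -I * ((a * b' - a' * b) * Real.exp x.2) := by
  simp only [moyal_affGen, Finset.sum_range_succ, Finset.sum_range_zero, moyalP_one_affGen]
  simp [moyalP]
  ring

theorem I_mul_eq_affGen (a b : ℂ) :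
    (fun y : ℝ × ℝ => I * (a * y.1 + b * Real.exp y.2)) = affGen (I * a) (I * b) := by
  funext y
  simp only [affGen]
  ring

/-- For `Z = αX + βY`, `T = α'X + β'Y` in `aff(ℝ)` with generating functions
`u = αp + βe^q`, `v = α'p + β'e^q`: all `P^r(u,v)` vanish for `r ≥ 2`, the star products
`(iu)⋆(iv)` and `(iv)⋆(iu)` are finite sums, and
`(iu)⋆(iv) − (iv)⋆(iu) = i·w` with `w = (αβ' − α'β)e^q` the generating function of
`[Z,T] = (αβ' − α'β)Y`. -/
theorem moyal_star_aff_bracket (α β α' β' : ℝ) :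
    (∀ r : ℕ, 2 ≤ r → ∀ x : ℝ × ℝ,
      moyalP r (fun y => (α * y.1 + β * Real.exp y.2 : ℂ))
        (fun y => (α' * y.1 + β' * Real.exp y.2 : ℂ)) x = 0) ∧
    (∀ x : ℝ × ℝ,
      moyal (fun y => I * (α * y.1 + β * Real.exp y.2))
          (fun y => I * (α' * y.1 + β' * Real.exp y.2)) x =
        ∑ r ∈ Finset.range 2, ((r.factorial : ℂ)⁻¹ * (1 / (2 * I)) ^ r *
          moyalP r (fun y => I * (α * y.1 + β * Real.exp y.2))
            (fun y => I * (α' * y.1 + β' * Real.exp y.2)) x) ∧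
      moyal (fun y => I * (α' * y.1 + β' * Real.exp y.2))
          (fun y => I * (α * y.1 + β * Real.exp y.2)) x =
        ∑ r ∈ Finset.range 2, ((r.factorial : ℂ)⁻¹ * (1 / (2 * I)) ^ r *
          moyalP r (fun y => I * (α' * y.1 + β' * Real.exp y.2))
            (fun y => I * (α * y.1 + β * Real.exp y.2)) x)) ∧
    (∀ x : ℝ × ℝ,
      moyal (fun y => I * (α * y.1 + β * Real.exp y.2))
          (fun y => I * (α' * y.1 + β' * Real.exp y.2)) x -
        moyal (fun y => I * (α' * y.1 + β' * Real.exp y.2))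
          (fun y => I * (α * y.1 + β * Real.exp y.2)) x =
      I * ((α * β' - α' * β) * Real.exp x.2)) := by
  refine ⟨fun r hr x => moyalP_affGen_eq_zero α β α' β' hr x, fun x => ?_, fun x => ?_⟩
  · simp only [I_mul_eq_affGen]
    exact ⟨moyal_affGen _ _ _ _ x, moyal_affGen _ _ _ _ x⟩
  · simp only [I_mul_eq_affGen, moyal_affGen_sub_swap]
    linear_combination (-I * ((α * β' - α' * β) * Real.exp x.2)) * I_mul_I
end

section
/- Let Z = αX + βY ∈ aff(ℝ) and let u : ℝ² → ℂ be smooth and compactly supported. Define v = 𝓕_p^{-1}(u) (inverse partial Fourier transform in the first variable), and define ℓ_Z(v) = i·(αp + βe^q)·v + ½·(α·∂_q v − β·e^q·∂_p v) + i·β·e^q·Σ_{r=2}^{∞} (1/r!)·(i/2)^r·∂_p^r v, the series converging absolutely since v extends to a function entire in p. Then 𝓕_p(ℓ_Z(𝓕_p^{-1}(u)))(x,q) = α·(½·∂_q u − ∂_x u)(x,q) + i·β·e^{q − x/2}·u(x,q). -/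
open Complex

/-- The partial Fourier transform in the first variable:
`𝓕_p(u)(x,q) = (1/√(2π)) ∫ e^{−ipx} u(p,q) dp`. -/
noncomputable def fourierP (u : ℝ × ℝ → ℂ) : ℝ × ℝ → ℂ :=
  fun x => (1 / Real.sqrt (2 * Real.pi) : ℝ) * ∫ p : ℝ, Complex.exp (-I * p * x.1) * u (p, x.2)

/-- The inverse partial Fourier transform in the first variable:
`𝓕_p⁻¹(u)(p,q) = (1/√(2π)) ∫ e^{ipx} u(x,q) dx`. -/
noncomputable def fourierPInv (u : ℝ × ℝ → ℂ) : ℝ × ℝ → ℂ :=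
  fun x => (1 / Real.sqrt (2 * Real.pi) : ℝ) * ∫ s : ℝ, Complex.exp (I * x.1 * s) * u (s, x.2)

/-- The operator `ℓ_Z` of left Moyal star-multiplication by `i·(αp + βe^q)`:
`ℓ_Z(v) = i(αp + βe^q)v + ½(α ∂_q v − β e^q ∂_p v) + i β e^q Σ_{r≥2} (1/r!)(i/2)^r ∂_p^r v`. -/
noncomputable def ellZ (α β : ℝ) (v : ℝ × ℝ → ℂ) : ℝ × ℝ → ℂ := fun x =>
  I * (α * x.1 + β * Real.exp x.2) * v x
    + (1 / 2 : ℂ) * (α * pderivQ v x - β * Real.exp x.2 * pderivP v x)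
    + I * β * Real.exp x.2 *
        ∑' r : ℕ, (((r + 2).factorial : ℂ)⁻¹ * (I / 2) ^ (r + 2) * (pderivP^[r + 2] v) x)

open MeasureTheory FourierTransform

theorem HasCompactSupport.slice_fst {E : Type*} [Zero E] {f : ℝ × ℝ → E}
    (hf : HasCompactSupport f) (q : ℝ) : HasCompactSupport fun s : ℝ => f (s, q) :=
  hf.comp_isClosedEmbedding (Topology.IsClosedEmbedding.of_continuous_injective_isClosedMap
    (by fun_prop) (fun _ _ h => (Prod.ext_iff.1 h).1) (isClosedMap_prodMk_right q))

theorem integrable_mul_slice {f : ℝ × ℝ → ℂ} (hf : Continuous f) (hc : HasCompactSupport f)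
    {g : ℝ → ℂ} (hg : Continuous g) (q : ℝ) : Integrable fun s : ℝ => g s * f (s, q) :=
  (hg.mul (hf.comp (by fun_prop))).integrable_of_hasCompactSupport (hc.slice_fst q).mul_left

theorem norm_exp_I_mul_ofReal_mul (p s : ℝ) : ‖Complex.exp (I * p * s)‖ = 1 := by
  simp [Complex.norm_exp]

theorem hasDerivAt_slice_fst {u : ℝ × ℝ → ℂ} (hu : Differentiable ℝ u) (s q : ℝ) :
    HasDerivAt (fun t : ℝ => u (t, q)) (fderiv ℝ u (s, q) (1, 0)) s :=
  (hu (s, q)).hasFDerivAt.comp_hasDerivAt s ((hasDerivAt_id s).prodMk (hasDerivAt_const s q))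

theorem hasDerivAt_slice_snd {u : ℝ × ℝ → ℂ} (hu : Differentiable ℝ u) (s q : ℝ) :
    HasDerivAt (fun t : ℝ => u (s, t)) (fderiv ℝ u (s, q) (0, 1)) q :=
  (hu (s, q)).hasFDerivAt.comp_hasDerivAt q ((hasDerivAt_const q s).prodMk (hasDerivAt_id q))

theorem pderivP_eq_fderiv {u : ℝ × ℝ → ℂ} (hu : Differentiable ℝ u) :
    pderivP u = fun x => fderiv ℝ u x (1, 0) :=
  funext fun x => (hasDerivAt_slice_fst hu x.1 x.2).deriv

theorem pderivQ_eq_fderiv {u : ℝ × ℝ → ℂ} (hu : Differentiable ℝ u) :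
    pderivQ u = fun x => fderiv ℝ u x (0, 1) :=
  funext fun x => (hasDerivAt_slice_snd hu x.1 x.2).deriv

/-- Differentiating `𝓕_p⁻¹ u` in `p` multiplies `u` by `i x`. -/
theorem pderivP_fourierPInv {u : ℝ × ℝ → ℂ} (hu : Continuous u) (hc : HasCompactSupport u) :
    pderivP (fourierPInv u) = fourierPInv fun x => I * x.1 * u x := by
  funext ⟨p, q⟩
  have key := (hasDerivAt_integral_of_dominated_loc_of_deriv_le (μ := volume) (x₀ := p)
    (F := fun (t : ℝ) (s : ℝ) => Complex.exp (I * t * s) * u (s, q))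
    (F' := fun (t : ℝ) (s : ℝ) => Complex.exp (I * t * s) * (I * s * u (s, q)))
    (bound := fun s : ℝ => ‖(s : ℂ) * u (s, q)‖) Filter.univ_mem
    (.of_forall fun t => (integrable_mul_slice hu hc (by fun_prop) q).aestronglyMeasurable)
    (integrable_mul_slice hu hc (by fun_prop) q)
    (Continuous.aestronglyMeasurable (by fun_prop))
    (.of_forall fun s t _ => by
      rw [norm_mul, norm_exp_I_mul_ofReal_mul]; simp)
    (integrable_mul_slice hu hc (by fun_prop) q).norm
    (.of_forall fun s t _ => by
      have h : HasDerivAt (fun t : ℝ => I * (t : ℂ) * s) (I * 1 * s) t :=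
        ((hasDerivAt_id t).ofReal_comp.const_mul I).mul_const _
      exact (h.cexp.mul_const (u (s, q))).congr_deriv (by ring))).2
  exact (key.const_mul _).deriv

theorem iterate_pderivP_fourierPInv {u : ℝ × ℝ → ℂ} (hu : Continuous u)
    (hc : HasCompactSupport u) (r : ℕ) :
    pderivP^[r] (fourierPInv u) = fourierPInv fun x => (I * x.1) ^ r * u x := by
  induction r with
  | zero => simp
  | succ r ih =>
    rw [Function.iterate_succ_apply', ih,
      pderivP_fourierPInv (u := fun x => (I * x.1) ^ r * u x) (by fun_prop) hc.mul_left]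
    simp only [pow_succ', mul_assoc]

/-- Differentiation in `q` commutes with `𝓕_p⁻¹`. -/
theorem pderivQ_fourierPInv {u : ℝ × ℝ → ℂ} (hu : ContDiff ℝ 1 u) (hc : HasCompactSupport u) :
    pderivQ (fourierPInv u) = fourierPInv (pderivQ u) := by
  have hd : Differentiable ℝ u := hu.differentiable one_ne_zero
  have hcont : Continuous fun x => fderiv ℝ u x (0, 1) :=
    (hu.continuous_fderiv one_ne_zero).clm_apply continuous_const
  have hcs : HasCompactSupport fun x => fderiv ℝ u x (0, 1) := hc.fderiv_apply ℝ (0, 1)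
  obtain ⟨C, hC⟩ := hcs.exists_bound_of_continuous hcont
  have hK : IsCompact (Prod.fst '' tsupport fun x => fderiv ℝ u x (0, 1)) :=
    hcs.isCompact.image continuous_fst
  rw [pderivQ_eq_fderiv hd]
  funext ⟨p, q⟩
  have key := (hasDerivAt_integral_of_dominated_loc_of_deriv_le (μ := volume) (x₀ := q)
    (F := fun (t : ℝ) (s : ℝ) => Complex.exp (I * p * s) * u (s, t))
    (F' := fun (t : ℝ) (s : ℝ) => Complex.exp (I * p * s) * fderiv ℝ u (s, t) (0, 1))
    (bound := (Prod.fst '' tsupport fun x => fderiv ℝ u x (0, 1)).indicator fun _ => C)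
    Filter.univ_mem
    (.of_forall fun t =>
      (integrable_mul_slice hu.continuous hc (by fun_prop) t).aestronglyMeasurable)
    (integrable_mul_slice hu.continuous hc (by fun_prop) q)
    (integrable_mul_slice hcont hcs (by fun_prop) q).aestronglyMeasurable
    (.of_forall fun s t _ => by
      rw [norm_mul, norm_exp_I_mul_ofReal_mul, one_mul]
      by_cases hs : s ∈ Prod.fst '' tsupport fun x => fderiv ℝ u x (0, 1)
      · rw [Set.indicator_of_mem hs]
        exact hC _
      · rw [Set.indicator_of_notMem hs, norm_le_zero_iff]
        exact image_eq_zero_of_notMem_tsupport (f := fun x => fderiv ℝ u x (0, 1))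
          fun h => hs ⟨_, h, rfl⟩)
    ((integrable_indicator_iff hK.measurableSet).2
      (integrableOn_const hK.measure_lt_top.ne))
    (.of_forall fun s t _ => (hasDerivAt_slice_snd hd s t).const_mul _)).2
  exact (key.const_mul _).deriv

/-- Multiplication by `i p` on the transform side is `-∂_x` on `u`. -/
theorem fourierPInv_pderivP {u : ℝ × ℝ → ℂ} (hu : ContDiff ℝ 1 u) (hc : HasCompactSupport u)
    (p q : ℝ) : fourierPInv (pderivP u) (p, q) = -(I * p * fourierPInv u (p, q)) := by
  have hd : Differentiable ℝ u := hu.differentiable one_ne_zero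
  have hcont : Continuous fun x => fderiv ℝ u x (1, 0) :=
    (hu.continuous_fderiv one_ne_zero).clm_apply continuous_const
  have hcs : HasCompactSupport fun x => fderiv ℝ u x (1, 0) := hc.fderiv_apply ℝ (1, 0)
  have key := integral_mul_deriv_eq_deriv_mul_of_integrable
    (u := fun s : ℝ => Complex.exp (I * p * s)) (u' := fun s : ℝ => I * p * Complex.exp (I * p * s))
    (v := fun s : ℝ => u (s, q)) (v' := fun s : ℝ => fderiv ℝ u (s, q) (1, 0))
    (fun s _ => by
      have h : HasDerivAt (fun s : ℝ => I * p * (s : ℂ)) (I * p * 1) s :=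
        (hasDerivAt_id s).ofReal_comp.const_mul _
      exact h.cexp.congr_deriv (by ring))
    (fun s _ => hasDerivAt_slice_fst hd s q)
    (integrable_mul_slice hcont hcs (by fun_prop) q)
    (integrable_mul_slice hu.continuous hc (by fun_prop) q)
    (integrable_mul_slice hu.continuous hc (by fun_prop) q)
  rw [pderivP_eq_fderiv hd]
  simp only [fourierPInv, key]
  simp only [mul_assoc, integral_const_mul]
  ring

/-- The full Moyal series in `∂_p` sums, on the transform side, to multiplication by
`e^{-x/2}`. -/
theorem hasSum_iterate_pderivP_fourierPInv {u : ℝ × ℝ → ℂ} (hu : Continuous u)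
    (hc : HasCompactSupport u) (p q : ℝ) :
    HasSum (fun r : ℕ => (r.factorial : ℂ)⁻¹ * (I / 2) ^ r *
        (pderivP^[r] (fourierPInv u)) (p, q))
      (fourierPInv (fun x => Complex.exp (-x.1 / 2) * u x) (p, q)) := by
  have key := hasSum_integral_of_dominated_convergence (μ := volume)
    (F := fun (r : ℕ) (s : ℝ) =>
      (-s / 2 : ℂ) ^ r / r.factorial * (Complex.exp (I * p * s) * u (s, q)))
    (f := fun s : ℝ => Complex.exp (-s / 2) * (Complex.exp (I * p * s) * u (s, q)))
    (fun (r : ℕ) (s : ℝ) => (|s| / 2) ^ r / r.factorial * ‖u (s, q)‖)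
    (fun r => Continuous.aestronglyMeasurable (by fun_prop))
    (fun r => .of_forall fun s => by
      rw [norm_mul, norm_mul, norm_exp_I_mul_ofReal_mul]
      simp)
    (.of_forall fun s => (Real.summable_pow_div_factorial _).mul_right _)
    (by
      have h (s : ℝ) : ∑' r : ℕ, (|s| / 2) ^ r / r.factorial * ‖u (s, q)‖ =
          Real.exp (|s| / 2) * ‖u (s, q)‖ := by
        rw [tsum_mul_right, Real.exp_eq_exp_ℝ, NormedSpace.exp_eq_tsum_div]
      simp only [h]
      exact (by fun_prop : Continuous fun s : ℝ => Real.exp (|s| / 2) * ‖u (s, q)‖)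
        |>.integrable_of_hasCompactSupport (hc.slice_fst q).norm.mul_left)
    (.of_forall fun s => by
      have h := NormedSpace.expSeries_div_hasSum_exp (-s / 2 : ℂ)
      rw [← Complex.exp_eq_exp_ℂ] at h
      exact h.mul_right _)
  have hlim : fourierPInv (fun x => Complex.exp (-x.1 / 2) * u x) (p, q) =
      (1 / Real.sqrt (2 * Real.pi) : ℝ) *
        ∫ s : ℝ, Complex.exp (-s / 2) * (Complex.exp (I * p * s) * u (s, q)) := by
    simp only [fourierPInv, mul_left_comm]
  have hterm (r : ℕ) : (r.factorial : ℂ)⁻¹ * (I / 2) ^ r *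
      (pderivP^[r] (fourierPInv u)) (p, q) = (1 / Real.sqrt (2 * Real.pi) : ℝ) *
        ∫ s : ℝ, (-s / 2 : ℂ) ^ r / r.factorial * (Complex.exp (I * p * s) * u (s, q)) := by
    rw [iterate_pderivP_fourierPInv hu hc, fourierPInv, mul_left_comm, ← integral_const_mul]
    congr 2
    funext s
    have h : (I / 2) ^ r * (I * (s : ℂ)) ^ r = (-s / 2 : ℂ) ^ r := by
      rw [← mul_pow]
      congr 1
      linear_combination (s / 2 : ℂ) * I_mul_I
    simp only [← h]
    ring
  simp only [hterm, hlim]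
  exact key.mul_left _

/-- Fourier inversion for smooth compactly supported functions. -/
theorem fourierP_fourierPInv {w : ℝ × ℝ → ℂ} (hw : ContDiff ℝ (⊤ : ℕ∞) w)
    (hc : HasCompactSupport w) (x q : ℝ) : fourierP (fourierPInv w) (x, q) = w (x, q) := by
  let g : SchwartzMap ℝ ℂ :=
    (hc.slice_fst q).toSchwartzMap (hw.comp (contDiff_id.prodMk contDiff_const))
  have hg (s : ℝ) : g s = w (s, q) := rfl
  have hinv (p : ℝ) : fourierPInv w (p, q) =
      (1 / Real.sqrt (2 * Real.pi) : ℝ) * 𝓕⁻ (g : ℝ → ℂ) ((2 * Real.pi)⁻¹ * p) := by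
    rw [fourierPInv, Real.fourierInv_eq']
    congr 2
    funext s
    simp only [hg, smul_eq_mul, RCLike.inner_apply, conj_trivial]
    congr 2
    push_cast
    field_simp
  have hfour : 𝓕 (𝓕⁻ (g : ℝ → ℂ)) x = w (x, q) := by
    rw [← SchwartzMap.fourierInv_coe, ← SchwartzMap.fourier_coe, fourier_fourierInv_eq, hg]
  rw [← hfour, Real.fourier_eq', fourierP]
  have hscale := Measure.integral_comp_mul_left
    (fun t : ℝ => Complex.exp (((-2 * Real.pi * inner ℝ t x : ℝ) : ℂ) * I) • 𝓕⁻ (g : ℝ → ℂ) t)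
    (2 * Real.pi)⁻¹
  rw [inv_inv, abs_of_pos Real.two_pi_pos] at hscale
  have hint : (∫ p : ℝ, Complex.exp (-I * p * x) * fourierPInv w (p, q)) =
      (1 / Real.sqrt (2 * Real.pi) : ℝ) * ∫ p : ℝ,
        Complex.exp (((-2 * Real.pi * inner ℝ ((2 * Real.pi)⁻¹ * p) x : ℝ) : ℂ) * I) •
          𝓕⁻ (g : ℝ → ℂ) ((2 * Real.pi)⁻¹ * p) := by
    rw [← integral_const_mul]
    congr 1
    funext p
    rw [hinv, smul_eq_mul, mul_left_comm]
    congr 3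
    simp only [RCLike.inner_apply, conj_trivial]
    push_cast
    field_simp
  rw [hint, hscale, ← mul_assoc, real_smul, ← mul_assoc, ← ofReal_mul, ← ofReal_mul]
  have hone : 1 / √(2 * Real.pi) * (1 / √(2 * Real.pi)) * (2 * Real.pi) = 1 := by
    rw [div_mul_div_comm, Real.mul_self_sqrt Real.two_pi_pos.le]
    field_simp
  rw [hone]
  simp

theorem fourierPInv_add {f g : ℝ × ℝ → ℂ} (hf : Continuous f) (hfc : HasCompactSupport f)
    (hg : Continuous g) (hgc : HasCompactSupport g) :
    fourierPInv (fun x => f x + g x) = fun x => fourierPInv f x + fourierPInv g x := by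
  funext x
  simp only [fourierPInv, mul_add]
  rw [integral_add (integrable_mul_slice hf hfc (by fun_prop) _)
    (integrable_mul_slice hg hgc (by fun_prop) _), mul_add]

/-- `𝓕_p⁻¹` is linear over functions of the second variable. -/
theorem fourierPInv_mul_snd (c : ℝ → ℂ) (f : ℝ × ℝ → ℂ) :
    fourierPInv (fun x => c x.2 * f x) = fun x => c x.2 * fourierPInv f x := by
  funext x
  simp only [fourierPInv, mul_left_comm _ (c x.2), integral_const_mul]

/-- `ℓ_Z` on inverse transforms, with the Moyal series summed. -/
theorem ellZ_fourierPInv (α β : ℝ) {u : ℝ × ℝ → ℂ} (hu : ContDiff ℝ 1 u)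
    (hc : HasCompactSupport u) (p q : ℝ) :
    ellZ α β (fourierPInv u) (p, q) =
      α * ((1 / 2 : ℂ) * fourierPInv (pderivQ u) (p, q) - fourierPInv (pderivP u) (p, q)) +
        I * β * Real.exp q * fourierPInv (fun x => Complex.exp (-x.1 / 2) * u x) (p, q) := by
  have hsum := hasSum_iterate_pderivP_fourierPInv hu.continuous hc p q
  have htail := hsum.summable.sum_add_tsum_nat_add 2
  rw [hsum.tsum_eq] at htail
  simp only [Finset.sum_range_succ, Finset.sum_range_zero, Function.iterate_zero,
    Function.iterate_one, id_eq, Nat.factorial, pow_zero, pow_one, Nat.cast_one, inv_one,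
    zero_add, one_mul, mul_one] at htail
  rw [← htail, fourierPInv_pderivP hu hc, ← pderivQ_fourierPInv hu hc]
  simp only [ellZ, Nat.factorial]
  linear_combination
    (-(β * Real.exp q * pderivP (fourierPInv u) (p, q) / 2) : ℂ) * I_mul_I

/-- For `Z = αX + βY ∈ aff(ℝ)` and a smooth compactly supported `u`, conjugating the left
star-multiplication operator `ℓ_Z` by the partial Fourier transform gives the first-order
operator `𝓕_p ∘ ℓ_Z ∘ 𝓕_p⁻¹(u) = α(½ ∂_q u − ∂_x u) + i β e^{q − x/2} u`. -/
theorem fourier_conjugate_ellZ (α β : ℝ) (u : ℝ × ℝ → ℂ)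
    (hu : ContDiff ℝ (⊤ : ℕ∞) u) (hsupp : HasCompactSupport u) (x q : ℝ) :
    fourierP (ellZ α β (fourierPInv u)) (x, q) =
      (α : ℂ) * ((1 / 2 : ℂ) * pderivQ u (x, q) - pderivP u (x, q))
        + I * β * Real.exp (q - x / 2) * u (x, q) := by
  have hu1 : ContDiff ℝ 1 u := hu.of_le (by exact_mod_cast le_top)
  have hd : Differentiable ℝ u := hu1.differentiable one_ne_zero
  have hfd : ContDiff ℝ (⊤ : ℕ∞) (fderiv ℝ u) := hu.fderiv_right (by norm_cast)
  have hP : ContDiff ℝ (⊤ : ℕ∞) (pderivP u) := by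
    rw [pderivP_eq_fderiv hd]; exact hfd.clm_apply contDiff_const
  have hQ : ContDiff ℝ (⊤ : ℕ∞) (pderivQ u) := by
    rw [pderivQ_eq_fderiv hd]; exact hfd.clm_apply contDiff_const
  have hPc : HasCompactSupport (pderivP u) := by
    rw [pderivP_eq_fderiv hd]; exact hsupp.fderiv_apply ℝ (1, 0)
  have hQc : HasCompactSupport (pderivQ u) := by
    rw [pderivQ_eq_fderiv hd]; exact hsupp.fderiv_apply ℝ (0, 1)
  have hofReal {f : ℝ × ℝ → ℝ} (hf : ContDiff ℝ (⊤ : ℕ∞) f) :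
      ContDiff ℝ (⊤ : ℕ∞) fun y => (f y : ℂ) := ofRealCLM.contDiff.comp hf
  have hE : ContDiff ℝ (⊤ : ℕ∞) fun y : ℝ × ℝ => Complex.exp (-y.1 / 2) * u y :=
    (((hofReal contDiff_fst).neg.div_const 2).cexp).mul hu
  have hEc : HasCompactSupport fun y : ℝ × ℝ => Complex.exp (-y.1 / 2) * u y := hsupp.mul_left
  have hR : ContDiff ℝ (⊤ : ℕ∞) fun y : ℝ × ℝ => (Real.exp y.2 : ℂ) :=
    hofReal contDiff_snd.exp
  have hA : ContDiff ℝ (⊤ : ℕ∞) fun y : ℝ × ℝ => (α / 2 : ℂ) * pderivQ u y :=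
    contDiff_const.mul hQ
  have hB : ContDiff ℝ (⊤ : ℕ∞) fun y : ℝ × ℝ => (-α : ℂ) * pderivP u y :=
    contDiff_const.mul hP
  have hD : ContDiff ℝ (⊤ : ℕ∞) fun y : ℝ × ℝ =>
      (I * β * Real.exp y.2 : ℂ) * (Complex.exp (-y.1 / 2) * u y) :=
    (contDiff_const.mul hR).mul hE
  have hell : ellZ α β (fourierPInv u) = fourierPInv fun y =>
      (α / 2 : ℂ) * pderivQ u y + (-α : ℂ) * pderivP u y +
        (I * β * Real.exp y.2 : ℂ) * (Complex.exp (-y.1 / 2) * u y) := by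
    rw [fourierPInv_add (hA.add hB).continuous (hQc.mul_left.add hPc.mul_left) hD.continuous
      hEc.mul_left, fourierPInv_add hA.continuous hQc.mul_left hB.continuous hPc.mul_left,
      fourierPInv_mul_snd (fun _ => (α / 2 : ℂ)), fourierPInv_mul_snd (fun _ => (-α : ℂ)),
      fourierPInv_mul_snd (fun t => (I * β * Real.exp t : ℂ))]
    funext ⟨p, t⟩
    rw [ellZ_fourierPInv α β hu1 hsupp]
    ring
  rw [hell, fourierP_fourierPInv ((hA.add hB).add hD)
    ((hQc.mul_left.add hPc.mul_left).add hEc.mul_left)]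
  have hexp : (Real.exp (q - x / 2) : ℂ) = Real.exp q * Complex.exp (-x / 2) := by
    push_cast
    rw [← Complex.exp_add]
    ring_nf
  rw [hexp]
  ring
end

section
/- Let A = (α, β) and B = (α', β') be elements of aff(ℂ), with generating functions Ã(p₁,q₁,p₂,q₂) = Re(α·z + β·e^w) and B̃ = Re(α'·z + β'·e^w), where z = p₁ + ip₂, w = q₁ + iq₂. Then their Poisson bracket with respect to the symplectic form dp₁∧dq₁ − dp₂∧dq₂ satisfies {Ã, B̃} = Re( (αβ' − α'β)·e^w ), which is the generating function of the Lie bracket [A,B] = (0, αβ' − α'β) in aff(ℂ). -/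
open Complex

/-- Partial derivative in `p₁`, for real functions of `(p₁,q₁,p₂,q₂)`. -/
noncomputable def dP₁ (f : ℝ × ℝ × ℝ × ℝ → ℝ) (x : ℝ × ℝ × ℝ × ℝ) : ℝ :=
  deriv (fun t : ℝ => f (t, x.2)) x.1

/-- Partial derivative in `q₁`. -/
noncomputable def dQ₁ (f : ℝ × ℝ × ℝ × ℝ → ℝ) (x : ℝ × ℝ × ℝ × ℝ) : ℝ :=
  deriv (fun t : ℝ => f (x.1, t, x.2.2)) x.2.1

/-- Partial derivative in `p₂`. -/
noncomputable def dP₂ (f : ℝ × ℝ × ℝ × ℝ → ℝ) (x : ℝ × ℝ × ℝ × ℝ) : ℝ :=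
  deriv (fun t : ℝ => f (x.1, x.2.1, t, x.2.2.2)) x.2.2.1

/-- Partial derivative in `q₂`. -/
noncomputable def dQ₂ (f : ℝ × ℝ × ℝ × ℝ → ℝ) (x : ℝ × ℝ × ℝ × ℝ) : ℝ :=
  deriv (fun t : ℝ => f (x.1, x.2.1, x.2.2.1, t)) x.2.2.2

/-- The generating function `Ã = Re(αz + βe^w)` of `A = (α,β) ∈ aff(ℂ)` on the open
coadjoint orbit, in the coordinates `(p₁,q₁,p₂,q₂)` with `z = p₁ + ip₂`, `w = q₁ + iq₂`. -/
noncomputable def genFun (α β : ℂ) (x : ℝ × ℝ × ℝ × ℝ) : ℝ :=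
  (α * (x.1 + x.2.2.1 * I) + β * Complex.exp (x.2.1 + x.2.2.2 * I)).re

/-- The derivative of the real part of a complex-valued function of a real variable. -/
theorem deriv_re_of_hasDerivAt {f : ℝ → ℂ} {f' : ℂ} {t : ℝ} (hf : HasDerivAt f f' t) :
    deriv (fun s => (f s).re) t = f'.re :=
  (Complex.reCLM.hasFDerivAt.comp_hasDerivAt t hf).deriv

theorem dP₁_genFun (α β : ℂ) (x : ℝ × ℝ × ℝ × ℝ) : dP₁ (genFun α β) x = α.re := by
  refine deriv_re_of_hasDerivAt ?_
  simpa using (((hasDerivAt_id x.1).ofReal_comp.add_const (x.2.2.1 * I : ℂ)).const_mul α).add_const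
    (β * Complex.exp (x.2.1 + x.2.2.2 * I))

theorem dP₂_genFun (α β : ℂ) (x : ℝ × ℝ × ℝ × ℝ) : dP₂ (genFun α β) x = (α * I).re := by
  refine deriv_re_of_hasDerivAt ?_
  simpa using ((((hasDerivAt_id x.2.2.1).ofReal_comp.mul_const I).const_add (x.1 : ℂ)).const_mul
    α).add_const (β * Complex.exp (x.2.1 + x.2.2.2 * I))

theorem dQ₁_genFun (α β : ℂ) (x : ℝ × ℝ × ℝ × ℝ) :
    dQ₁ (genFun α β) x = (β * Complex.exp (x.2.1 + x.2.2.2 * I)).re := by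
  refine deriv_re_of_hasDerivAt ?_
  simpa using ((((hasDerivAt_id x.2.1).ofReal_comp.add_const (x.2.2.2 * I : ℂ)).cexp).const_mul
    β).const_add (α * (x.1 + x.2.2.1 * I))

theorem dQ₂_genFun (α β : ℂ) (x : ℝ × ℝ × ℝ × ℝ) :
    dQ₂ (genFun α β) x = (β * (Complex.exp (x.2.1 + x.2.2.2 * I) * I)).re := by
  refine deriv_re_of_hasDerivAt ?_
  simpa using (((((hasDerivAt_id x.2.2.2).ofReal_comp.mul_const I).const_add
    (x.2.1 : ℂ)).cexp).const_mul β).const_add (α * (x.1 + x.2.2.1 * I))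

/-- For `A = (α,β)`, `B = (α',β')` in `aff(ℂ)` with generating functions
`Ã = Re(αz + βe^w)`, `B̃ = Re(α'z + β'e^w)`, the Poisson bracket of the symplectic form
`dp₁∧dq₁ − dp₂∧dq₂` satisfies `{Ã,B̃} = Re((αβ' − α'β)e^w)`, the generating function of
the Lie bracket `[A,B] = (0, αβ' − α'β)`. -/
theorem poisson_bracket_generating_functions (α β α' β' : ℂ) (x : ℝ × ℝ × ℝ × ℝ) :
    dP₁ (genFun α β) x * dQ₁ (genFun α' β') x - dQ₁ (genFun α β) x * dP₁ (genFun α' β') x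
      - dP₂ (genFun α β) x * dQ₂ (genFun α' β') x
      + dQ₂ (genFun α β) x * dP₂ (genFun α' β') x =
      ((α * β' - α' * β) * Complex.exp (x.2.1 + x.2.2.2 * I)).re := by
  rw [dP₁_genFun, dP₁_genFun, dP₂_genFun, dP₂_genFun, dQ₁_genFun, dQ₁_genFun, dQ₂_genFun,
    dQ₂_genFun]
  generalize Complex.exp (x.2.1 + x.2.2.2 * I) = E
  simp only [mul_re, mul_im, sub_re, sub_im, I_re, I_im]
  ring
end
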